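/- arXiv:2207.09218 — 6 statements merged into one kernel-verified Lean document; each statement's English description precedes it below -/
import Mathlib

section
/- Let c₁, c₂, g₁, g₂, d : [0,1] → ℝ be continuous with d(x) > 0 for all x ∈ [0,1], and let α ∈ ℝ. Then the system of ordinary differential equations −V'(x) + c₁(x) V(x) = g₁(x) and −W'(x) + c₂(x) W(x) + d(x) V(x) = g₂(x) for x ∈ (0,1), with the conditions W(1) = 0 and V(1) = W(0) + α, has exactly one solution pair (V, W) of C¹ functions on [0,1]. -/
open Set

/-- A continuous function on `ℝ` has an antiderivative. -/
lemma exists_antiderivative {f : ℝ → ℝ} (hf : Continuous f) :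
    ∃ F : ℝ → ℝ, ∀ x, HasDerivAt F (f x) x :=
  ⟨fun x => ∫ t in (0:ℝ)..x, f t, fun x => (hf.integral_hasStrictDerivAt 0 x).hasDerivAt⟩

/-- The initial value problem `y' = a y + b`, `y x₀ = y₀` has a global solution. -/
lemma exists_linear_ode_solution {a b : ℝ → ℝ} (ha : Continuous a) (hb : Continuous b)
    (x₀ y₀ : ℝ) :
    ∃ y : ℝ → ℝ, (∀ x, HasDerivAt y (a x * y x + b x) x) ∧ y x₀ = y₀ := by
  obtain ⟨A, hA⟩ := exists_antiderivative ha
  have hAc : Continuous A := continuous_iff_continuousAt.2 fun x => (hA x).continuousAt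
  obtain ⟨B, hB⟩ := exists_antiderivative
    (f := fun x => Real.exp (-A x) * b x) (by fun_prop)
  refine ⟨fun x => Real.exp (A x) * (B x - B x₀ + Real.exp (-A x₀) * y₀), fun x => ?_, ?_⟩
  · refine ((hA x).exp.mul (((hB x).sub_const (B x₀)).add_const
      (Real.exp (-A x₀) * y₀))).congr_deriv ?_
    have h : Real.exp (A x) * Real.exp (-A x) = 1 := by simp [← Real.exp_add]
    linear_combination b x * h
  · have h : Real.exp (A x₀) * Real.exp (-A x₀) = 1 := by simp [← Real.exp_add]
    linear_combination y₀ * h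

/-- Multiplying by an integrating factor removes the homogeneous part of `y' = a y + b`. -/
lemma HasDerivAt.integrating_factor {A y : ℝ → ℝ} {a b x : ℝ} (hA : HasDerivAt A a x)
    (hy : HasDerivAt y (a * y x + b) x) :
    HasDerivAt (fun t => Real.exp (-A t) * y t) (Real.exp (-A x) * b) x :=
  (hA.neg.exp.mul hy).congr_deriv (by simp only [Pi.neg_apply]; ring)

/-- A solution of `y' = a y` on `(0,1)` has the form `K exp A` on `[0,1]`, where `A' = a`. -/
lemma exists_eq_mul_exp {a A y : ℝ → ℝ} (hA : ∀ x, HasDerivAt A (a x) x)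
    (hyc : ContinuousOn y (Icc 0 1))
    (hy : ∀ x ∈ Ioo (0:ℝ) 1, HasDerivAt y (a x * y x) x) :
    ∃ K : ℝ, ∀ x ∈ Icc (0:ℝ) 1, y x = K * Real.exp (A x) := by
  have hAc : Continuous A := continuous_iff_continuousAt.2 fun x => (hA x).continuousAt
  have hc : ContinuousOn (fun t => Real.exp (-A t) * y t) (Icc 0 1) :=
    (by fun_prop : Continuous fun t => Real.exp (-A t)).continuousOn.mul hyc
  have hder : ∀ x ∈ Ioo (0:ℝ) 1, HasDerivAt (fun t => Real.exp (-A t) * y t) 0 x := by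
    intro x hx
    simpa using (hA x).integrating_factor (b := 0) (by simpa using hy x hx)
  refine ⟨Real.exp (-A 0) * y 0, fun x hx => ?_⟩
  have hconst : Real.exp (-A x) * y x = Real.exp (-A 0) * y 0 := by
    rcases hx.1.eq_or_lt with rfl | h0
    · rfl
    obtain ⟨ξ, hξ, h⟩ := exists_hasDerivAt_eq_slope (fun t => Real.exp (-A t) * y t)
      (fun _ => 0) h0 (hc.mono (Icc_subset_Icc_right hx.2))
      fun t ht => hder t ⟨ht.1, ht.2.trans_le hx.2⟩
    rw [eq_div_iff (by linarith)] at h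
    linarith
  have h : Real.exp (A x) * Real.exp (-A x) = 1 := by simp [← Real.exp_add]
  linear_combination -y x * h + Real.exp (A x) * hconst

/-- The homogeneous system with `w 1 = 0` and `v 1 = w 0` has no solution with `v > 0`. -/
lemma not_forall_pos_of_homogeneous_system {c d v w : ℝ → ℝ} (hc : Continuous c)
    (hd : ∀ x ∈ Icc (0:ℝ) 1, 0 < d x)
    (hwc : ContinuousOn w (Icc 0 1))
    (hw : ∀ x ∈ Ioo (0:ℝ) 1, HasDerivAt w (c x * w x + d x * v x) x)
    (hw1 : w 1 = 0) (hvw : v 1 = w 0) : ¬ ∀ x ∈ Icc (0:ℝ) 1, 0 < v x := by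
  intro hpos
  obtain ⟨A, hA⟩ := exists_antiderivative hc
  have hAc : Continuous A := continuous_iff_continuousAt.2 fun x => (hA x).continuousAt
  obtain ⟨ξ, hξ, h⟩ := exists_hasDerivAt_eq_slope (fun t => Real.exp (-A t) * w t)
    (fun x => Real.exp (-A x) * (d x * v x)) zero_lt_one
    ((by fun_prop : Continuous fun t => Real.exp (-A t)).continuousOn.mul hwc)
    fun t ht => (hA t).integrating_factor (hw t ht)
  have hξ' := Ioo_subset_Icc_self hξ
  have h1 : 0 < Real.exp (-A ξ) * (d ξ * v ξ) :=
    mul_pos (Real.exp_pos _) (mul_pos (hd ξ hξ') (hpos ξ hξ'))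
  have h2 : 0 < Real.exp (-A 0) * w 0 :=
    mul_pos (Real.exp_pos _) (hvw ▸ hpos 1 (by simp))
  simp only [hw1, mul_zero, sub_zero, div_one] at h
  linarith

/-- The homogeneous system with `w 1 = 0` and `v 1 = w 0` has only the trivial solution. -/
lemma homogeneous_system_eq_zero {c₁ c₂ d v w : ℝ → ℝ} (hc₁ : Continuous c₁)
    (hc₂ : Continuous c₂) (hd : ∀ x ∈ Icc (0:ℝ) 1, 0 < d x)
    (hvc : ContinuousOn v (Icc 0 1)) (hwc : ContinuousOn w (Icc 0 1))
    (hv : ∀ x ∈ Ioo (0:ℝ) 1, HasDerivAt v (c₁ x * v x) x)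
    (hw : ∀ x ∈ Ioo (0:ℝ) 1, HasDerivAt w (c₂ x * w x + d x * v x) x)
    (hw1 : w 1 = 0) (hvw : v 1 = w 0) :
    ∀ x ∈ Icc (0:ℝ) 1, v x = 0 ∧ w x = 0 := by
  obtain ⟨A, hA⟩ := exists_antiderivative hc₁
  obtain ⟨B, hB⟩ := exists_antiderivative hc₂
  obtain ⟨K, hK⟩ := exists_eq_mul_exp hA hvc hv
  have hK0 : K = 0 := by
    rcases lt_trichotomy K 0 with h | h | h
    · refine absurd (fun x hx => ?_) (not_forall_pos_of_homogeneous_system (v := -v) hc₂ hd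
        hwc.neg (fun x hx => (hw x hx).neg.congr_deriv ?_) (by simp [hw1]) (by simp [hvw]))
      · simpa [hK x hx] using mul_neg_of_neg_of_pos h (Real.exp_pos (A x))
      · simp only [Pi.neg_apply]; ring
    · exact h
    · refine absurd (fun x hx => ?_)
        (not_forall_pos_of_homogeneous_system hc₂ hd hwc hw hw1 hvw)
      rw [hK x hx]
      exact mul_pos h (Real.exp_pos _)
  have hv0 : ∀ x ∈ Icc (0:ℝ) 1, v x = 0 := fun x hx => by simp [hK x hx, hK0]
  obtain ⟨L, hL⟩ := exists_eq_mul_exp hB hwc fun x hx =>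
    (hw x hx).congr_deriv (by simp [hv0 x (Ioo_subset_Icc_self hx)])
  have hL0 : L = 0 := by simpa [hw1] using (hL 1 (by simp)).symm
  exact fun x hx => ⟨hv0 x hx, by simp [hL x hx, hL0]⟩

/-- A solution of `y' = a y + b` with continuous coefficients is `C¹`. -/
lemma contDiff_of_linear_ode {a b y : ℝ → ℝ} (ha : Continuous a) (hb : Continuous b)
    (hy : ∀ x, HasDerivAt y (a x * y x + b x) x) : ContDiff ℝ 1 y := by
  have hyc : Continuous y := continuous_iff_continuousAt.2 fun x => (hy x).continuousAt
  refine contDiff_one_iff_deriv.2 ⟨fun x => (hy x).differentiableAt, ?_⟩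
  rw [show deriv y = fun x => a x * y x + b x from funext fun x => (hy x).deriv]
  fun_prop

/-- For globally continuous data, the system with `W 1 = 0` and `V 1 = W 0 + α` has a
global solution. -/
lemma exists_system_solution {c₁ c₂ g₁ g₂ d : ℝ → ℝ} (hc₁ : Continuous c₁)
    (hc₂ : Continuous c₂) (hg₁ : Continuous g₁) (hg₂ : Continuous g₂) (hdc : Continuous d)
    (hd : ∀ x ∈ Icc (0:ℝ) 1, 0 < d x) (α : ℝ) :
    ∃ V W : ℝ → ℝ, ContDiff ℝ 1 V ∧ ContDiff ℝ 1 W ∧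
      (∀ x, HasDerivAt V (c₁ x * V x - g₁ x) x) ∧
      (∀ x, HasDerivAt W (c₂ x * W x + d x * V x - g₂ x) x) ∧
      W 1 = 0 ∧ V 1 = W 0 + α := by
  obtain ⟨v, hv, hv0⟩ := exists_linear_ode_solution hc₁ continuous_zero 0 1
  have hvc : Continuous v := continuous_iff_continuousAt.2 fun x => (hv x).continuousAt
  obtain ⟨w, hw, hw1⟩ := exists_linear_ode_solution hc₂ (hdc.mul hvc) 1 0
  have hwc : Continuous w := continuous_iff_continuousAt.2 fun x => (hw x).continuousAt
  have hne : v 1 - w 0 ≠ 0 := fun h => by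
    have := (homogeneous_system_eq_zero hc₁ hc₂ hd hvc.continuousOn hwc.continuousOn
      (fun x _ => (hv x).congr_deriv (by simp)) (fun x _ => hw x) hw1
      (sub_eq_zero.1 h) 0 (by simp)).1
    simp [hv0] at this
  obtain ⟨p, hp, -⟩ := exists_linear_ode_solution hc₁ hg₁.neg 0 0
  have hpc : Continuous p := continuous_iff_continuousAt.2 fun x => (hp x).continuousAt
  obtain ⟨q, hq, hq1⟩ := exists_linear_ode_solution hc₂ ((hdc.mul hpc).sub hg₂) 1 0
  obtain ⟨t, ht⟩ : ∃ t, t * (v 1 - w 0) = q 0 + α - p 1 := ⟨_, div_mul_cancel₀ _ hne⟩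
  refine ⟨fun x => p x + t * v x, fun x => q x + t * w x,
    (contDiff_of_linear_ode hc₁ hg₁.neg hp).add
      (contDiff_const.mul (contDiff_of_linear_ode hc₁ continuous_zero hv)),
    (contDiff_of_linear_ode hc₂ ((hdc.mul hpc).sub hg₂) hq).add
      (contDiff_const.mul (contDiff_of_linear_ode hc₂ (hdc.mul hvc) hw)),
    fun x => ((hp x).add ((hv x).const_mul t)).congr_deriv ?_,
    fun x => ((hq x).add ((hw x).const_mul t)).congr_deriv ?_, ?_, ?_⟩
  · simp only [Pi.zero_apply, Pi.neg_apply]; ring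
  · simp only [Pi.mul_apply, Pi.sub_apply]; ring
  · simp [hq1, hw1]
  · linear_combination ht

/-- A continuous function on `[0,1]` extends to a continuous function on `ℝ`. -/
lemma exists_continuous_eqOn_Icc {f : ℝ → ℝ} (hf : ContinuousOn f (Icc 0 1)) :
    ∃ F : ℝ → ℝ, Continuous F ∧ EqOn F f (Icc 0 1) :=
  ⟨IccExtend zero_le_one ((Icc (0:ℝ) 1).domRestrict f), hf.domRestrict.Icc_extend',
    fun _ hx => IccExtend_of_mem _ _ hx⟩

/-- The linear first-order ODE system `−V' + c₁ V = g₁`, `−W' + c₂ W + d V = g₂` on `(0,1)`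
with the nonlocal boundary conditions `W(1) = 0` and `V(1) = W(0) + α` has exactly one
solution pair of `C¹` functions on `[0,1]`, provided `d > 0` on `[0,1]`. -/
theorem ode_system_existence_uniqueness
    (c₁ c₂ g₁ g₂ d : ℝ → ℝ)
    (hc₁ : ContinuousOn c₁ (Icc 0 1)) (hc₂ : ContinuousOn c₂ (Icc 0 1))
    (hg₁ : ContinuousOn g₁ (Icc 0 1)) (hg₂ : ContinuousOn g₂ (Icc 0 1))
    (hdcont : ContinuousOn d (Icc 0 1)) (hd : ∀ x ∈ Icc (0:ℝ) 1, 0 < d x)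
    (α : ℝ) :
    ∃ V W : ℝ → ℝ,
      (ContDiffOn ℝ 1 V (Icc 0 1) ∧ ContDiffOn ℝ 1 W (Icc 0 1) ∧
        (∀ x ∈ Ioo (0:ℝ) 1, -deriv V x + c₁ x * V x = g₁ x) ∧
        (∀ x ∈ Ioo (0:ℝ) 1, -deriv W x + c₂ x * W x + d x * V x = g₂ x) ∧
        W 1 = 0 ∧ V 1 = W 0 + α) ∧
      (∀ V' W' : ℝ → ℝ,
        (ContDiffOn ℝ 1 V' (Icc 0 1) ∧ ContDiffOn ℝ 1 W' (Icc 0 1) ∧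
          (∀ x ∈ Ioo (0:ℝ) 1, -deriv V' x + c₁ x * V' x = g₁ x) ∧
          (∀ x ∈ Ioo (0:ℝ) 1, -deriv W' x + c₂ x * W' x + d x * V' x = g₂ x) ∧
          W' 1 = 0 ∧ V' 1 = W' 0 + α) →
        ∀ x ∈ Icc (0:ℝ) 1, V' x = V x ∧ W' x = W x) := by
  obtain ⟨C₁, hC₁, e₁⟩ := exists_continuous_eqOn_Icc hc₁
  obtain ⟨C₂, hC₂, e₂⟩ := exists_continuous_eqOn_Icc hc₂
  obtain ⟨G₁, hG₁, f₁⟩ := exists_continuous_eqOn_Icc hg₁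
  obtain ⟨G₂, hG₂, f₂⟩ := exists_continuous_eqOn_Icc hg₂
  obtain ⟨D, hD, eD⟩ := exists_continuous_eqOn_Icc hdcont
  have hDpos : ∀ x ∈ Icc (0:ℝ) 1, 0 < D x := fun x hx => by rw [eD hx]; exact hd x hx
  obtain ⟨V, W, hVc, hWc, hV, hW, hW1, hVW⟩ :=
    exists_system_solution hC₁ hC₂ hG₁ hG₂ hD hDpos α
  refine ⟨V, W, ⟨hVc.contDiffOn, hWc.contDiffOn, fun x hx => ?_, fun x hx => ?_, hW1, hVW⟩, ?_⟩
  · have hx' := Ioo_subset_Icc_self hx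
    rw [(hV x).deriv, e₁ hx', f₁ hx']; ring
  · have hx' := Ioo_subset_Icc_self hx
    rw [(hW x).deriv, e₂ hx', f₂ hx', eD hx']; ring
  rintro V' W' ⟨hVc', hWc', hV', hW', hW1', hVW'⟩
  have hdiff : ∀ {y : ℝ → ℝ}, ContDiffOn ℝ 1 y (Icc 0 1) → ∀ x ∈ Ioo (0:ℝ) 1,
      HasDerivAt y (deriv y x) x := fun hy x hx =>
    ((hy.differentiableOn one_ne_zero).differentiableAt (Icc_mem_nhds hx.1 hx.2)).hasDerivAt
  have key := homogeneous_system_eq_zero (v := V' - V) (w := W' - W) hC₁ hC₂ hDpos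
    (hVc'.continuousOn.sub hVc.continuous.continuousOn)
    (hWc'.continuousOn.sub hWc.continuous.continuousOn)
    (fun x hx => ((hdiff hVc' x hx).sub (hV x)).congr_deriv (by
      have hx' := Ioo_subset_Icc_self hx
      have := hV' x hx
      rw [e₁ hx', f₁ hx', Pi.sub_apply]
      linear_combination -this))
    (fun x hx => ((hdiff hWc' x hx).sub (hW x)).congr_deriv (by
      have hx' := Ioo_subset_Icc_self hx
      have := hW' x hx
      rw [e₂ hx', f₂ hx', eD hx', Pi.sub_apply, Pi.sub_apply]
      linear_combination -this))
    (by simp [hW1, hW1']) (by simp [hVW, hVW'])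
  exact fun x hx => ⟨sub_eq_zero.1 (key x hx).1, sub_eq_zero.1 (key x hx).2⟩
end

section
/- Let f : [0,1] → ℝ be continuous and define u(x) = ∫₀¹ G(x,t) f(t) dt. Then u ∈ C²([0,1]), u(0) = u(1) = 0, and −ε u''(x) − b u'(x) + c u(x) = f(x) for all x ∈ (0,1). -/
open Set

/-- A function with a continuous second derivative is `C²`. -/
theorem contDiff_two_of_hasDerivAt {U U' U'' : ℝ → ℝ} (h : ∀ x, HasDerivAt U (U' x) x)
    (h' : ∀ x, HasDerivAt U' (U'' x) x) (hc : Continuous U'') : ContDiff ℝ 2 U := by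
  have e : deriv U = U' := funext fun x => (h x).deriv
  have e' : deriv U' = U'' := funext fun x => (h' x).deriv
  have h1 : ContDiff ℝ 1 U' :=
    contDiff_one_iff_deriv.2 ⟨fun x => (h' x).differentiableAt, e' ▸ hc⟩
  rw [show (2 : WithTop ℕ∞) = 1 + 1 from one_add_one_eq_two.symm, contDiff_succ_iff_deriv]
  exact ⟨fun x => (h x).differentiableAt, by simp, e ▸ h1⟩

/-- Splitting the integral of a two-branch separable kernel at the diagonal. -/
theorem integral_ite_mul_eq {v₁ v₂ g : ℝ → ℝ} (hv₁ : Continuous v₁) (hv₂ : Continuous v₂)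
    (hg : Continuous g) {a b x : ℝ} (hx : x ∈ Icc a b) :
    ∫ t in a..b, (if x ≤ t then v₁ x * v₂ t else v₁ t * v₂ x) * g t =
      v₂ x * (∫ t in a..x, v₁ t * g t) - v₁ x * ∫ t in b..x, v₂ t * g t := by
  have hl : EqOn (fun t => v₂ x * (v₁ t * g t))
      (fun t => (if x ≤ t then v₁ x * v₂ t else v₁ t * v₂ x) * g t) (uIcc a x) := by
    intro t ht
    rw [uIcc_of_le hx.1] at ht
    rcases ht.2.lt_or_eq with h | rfl
    · simp only [if_neg h.not_ge]; ring
    · simp only [le_refl, if_true]; ring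
  have hr : EqOn (fun t => v₁ x * (v₂ t * g t))
      (fun t => (if x ≤ t then v₁ x * v₂ t else v₁ t * v₂ x) * g t) (uIcc x b) := by
    intro t ht
    rw [uIcc_of_le hx.2] at ht
    simp only [if_pos ht.1]; ring
  have il : IntervalIntegrable (fun t => v₂ x * (v₁ t * g t)) MeasureTheory.volume a x :=
    (by fun_prop : Continuous fun t => v₂ x * (v₁ t * g t)).intervalIntegrable _ _
  have ir : IntervalIntegrable (fun t => v₁ x * (v₂ t * g t)) MeasureTheory.volume x b :=
    (by fun_prop : Continuous fun t => v₁ x * (v₂ t * g t)).intervalIntegrable _ _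
  rw [← intervalIntegral.integral_add_adjacent_intervals
      (il.congr (hl.mono uIoc_subset_uIcc)) (ir.congr (hr.mono uIoc_subset_uIcc)),
    ← intervalIntegral.integral_congr hl, ← intervalIntegral.integral_congr hr,
    intervalIntegral.integral_const_mul, intervalIntegral.integral_const_mul,
    intervalIntegral.integral_symm b x]
  ring

/-- The Green's function representation `u(x) = ∫₀¹ G(x,t) f(t) dt` yields a `C²` solution
of the boundary value problem `−ε u'' − b u' + c u = f` on `(0,1)` with `u(0) = u(1) = 0`. -/
theorem green_function_solves_bvp
    (b c ε : ℝ) (hb : 0 < b) (hc : 0 < c) (hε : 0 < ε)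
    (v₁ v₂ w : ℝ → ℝ) (G : ℝ → ℝ → ℝ)
    (hv₁ : ContDiff ℝ 2 v₁) (hv₂ : ContDiff ℝ 2 v₂)
    (hode₁ : ∀ x, -ε * deriv (deriv v₁) x - b * deriv v₁ x + c * v₁ x = 0)
    (hv₁0 : v₁ 0 = 0) (hv₁0' : deriv v₁ 0 = 1)
    (hode₂ : ∀ x, -ε * deriv (deriv v₂) x - b * deriv v₂ x + c * v₂ x = 0)
    (hv₂1 : v₂ 1 = 0) (hv₂1' : deriv v₂ 1 = 1)
    (hw : w = fun x => v₁ x * deriv v₂ x - deriv v₁ x * v₂ x)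
    (hw0 : ∀ x ∈ Icc (0:ℝ) 1, w x ≠ 0)
    (hG : G = fun x t =>
      if x ≤ t then -(v₁ x * v₂ t) / (ε * w t) else -(v₁ t * v₂ x) / (ε * w t))
    (f : ℝ → ℝ) (hf : ContinuousOn f (Icc 0 1))
    (u : ℝ → ℝ) (hu : u = fun x => ∫ t in (0:ℝ)..1, G x t * f t) :
    ContDiffOn ℝ 2 u (Icc 0 1) ∧ u 0 = 0 ∧ u 1 = 0 ∧
      ∀ x ∈ Ioo (0:ℝ) 1, -ε * deriv (deriv u) x - b * deriv u x + c * u x = f x := by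
  have hε0 := hε.ne'
  have hd₁ : ContDiff ℝ 1 (deriv v₁) := hv₁.deriv'
  have hd₂ : ContDiff ℝ 1 (deriv v₂) := hv₂.deriv'
  have D₁ : ∀ x, HasDerivAt v₁ (deriv v₁ x) x := fun x =>
    (hv₁.differentiable (by simp) x).hasDerivAt
  have D₂ : ∀ x, HasDerivAt v₂ (deriv v₂ x) x := fun x =>
    (hv₂.differentiable (by simp) x).hasDerivAt
  have DD₁ : ∀ x, HasDerivAt (deriv v₁) (deriv (deriv v₁) x) x := fun x =>
    (hd₁.differentiable (by simp) x).hasDerivAt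
  have DD₂ : ∀ x, HasDerivAt (deriv v₂) (deriv (deriv v₂) x) x := fun x =>
    (hd₂.differentiable (by simp) x).hasDerivAt
  have cv₁ := hv₁.continuous
  have cv₂ := hv₂.continuous
  have cd₁ := hd₁.continuous
  have cd₂ := hd₂.continuous
  have cdd₁ : Continuous (deriv (deriv v₁)) := hd₁.continuous_deriv le_rfl
  have cdd₂ : Continuous (deriv (deriv v₂)) := hd₂.continuous_deriv le_rfl
  have cw : Continuous w := by rw [hw]; fun_prop
  obtain ⟨g, cg, hg⟩ : ∃ g : ℝ → ℝ, Continuous g ∧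
      ∀ t ∈ Icc (0:ℝ) 1, g t = -(f t) / (ε * w t) := by
    have h : ContinuousOn (fun t => -(f t) / (ε * w t)) (Icc 0 1) :=
      hf.neg.div (by fun_prop) fun t ht => mul_ne_zero hε0 (hw0 t ht)
    exact ⟨IccExtend zero_le_one ((Icc (0:ℝ) 1).domRestrict fun t => -(f t) / (ε * w t)),
      h.domRestrict.Icc_extend', fun t ht => IccExtend_of_mem _ _ ht⟩
  set A : ℝ → ℝ := fun x => ∫ t in (0:ℝ)..x, v₁ t * g t with hA
  set B : ℝ → ℝ := fun x => ∫ t in (1:ℝ)..x, v₂ t * g t with hB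
  have DA : ∀ x, HasDerivAt A (v₁ x * g x) x := fun x =>
    (cv₁.mul cg).integral_hasStrictDerivAt 0 x |>.hasDerivAt
  have DB : ∀ x, HasDerivAt B (v₂ x * g x) x := fun x =>
    (cv₂.mul cg).integral_hasStrictDerivAt 1 x |>.hasDerivAt
  have cA : Continuous A := continuous_iff_continuousAt.2 fun x => (DA x).continuousAt
  have cB : Continuous B := continuous_iff_continuousAt.2 fun x => (DB x).continuousAt
  set U : ℝ → ℝ := fun x => v₂ x * A x - v₁ x * B x with hU
  set U' : ℝ → ℝ := fun x => deriv v₂ x * A x - deriv v₁ x * B x with hU'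
  set U'' : ℝ → ℝ := fun x =>
    deriv (deriv v₂) x * A x - deriv (deriv v₁) x * B x + w x * g x with hU''
  have DU : ∀ x, HasDerivAt U (U' x) x := fun x =>
    (((D₂ x).mul (DA x)).sub ((D₁ x).mul (DB x))).congr_deriv (by simp only [hU']; ring)
  have DU' : ∀ x, HasDerivAt U' (U'' x) x := fun x =>
    (((DD₂ x).mul (DA x)).sub ((DD₁ x).mul (DB x))).congr_deriv
      (by simp only [hU'', hw]; ring)
  have huU : EqOn u U (Icc 0 1) := by
    intro x hx
    simp only [hu, hU, hA, hB]
    rw [← integral_ite_mul_eq cv₁ cv₂ cg hx]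
    refine intervalIntegral.integral_congr fun t ht => ?_
    rw [uIcc_of_le zero_le_one] at ht
    simp only [hG, hg t ht]
    split_ifs <;> ring
  refine ⟨(contDiff_two_of_hasDerivAt DU DU' (by fun_prop)).contDiffOn.congr huU, ?_, ?_, ?_⟩
  · rw [huU (by simp)]; simp [hU, hA, hv₁0]
  · rw [huU (by simp)]; simp [hU, hB, hv₂1]
  · intro x hx
    have hev : u =ᶠ[nhds x] U := huU.eventuallyEq_of_mem (Icc_mem_nhds hx.1 hx.2)
    have hx' := Ioo_subset_Icc_self hx
    rw [hev.deriv.deriv_eq, hev.deriv_eq, huU hx', show deriv U = U' from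
      funext fun y => (DU y).deriv, (DU' x).deriv]
    have hwg : ε * (w x * g x) = -f x := by
      have := hw0 x hx'
      rw [hg x hx']; field_simp
    simp only [hU, hU', hU'']
    linear_combination A x * hode₂ x - B x * hode₁ x - hwg
end

section
/- There exist constants C > 0 and ε₀ > 0, depending only on b and c, such that for every ε ∈ (0, ε₀] and every x ∈ [0,1] it holds ∫₀¹ |G(x,t)| dt ≤ C. -/
open Set

/-- A function whose derivative is `r` times itself is a multiple of `exp (r * x)`. -/
theorem eq_mul_exp_of_hasDerivAt {h : ℝ → ℝ} {r : ℝ}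
    (hh : ∀ x, HasDerivAt h (r * h x) x) (a x : ℝ) :
    h x = h a * Real.exp (r * (x - a)) := by
  have hd : ∀ y, HasDerivAt (fun y => h y * Real.exp (-(r * (y - a)))) 0 y := by
    intro y
    have he : HasDerivAt (fun y : ℝ => -(r * (y - a))) (-(r * 1)) y :=
      (((hasDerivAt_id y).sub_const a).const_mul r).neg
    refine HasDerivAt.congr_deriv ((hh y).mul he.exp) ?_
    ring
  have hc := is_const_of_deriv_eq_zero (fun y => (hd y).differentiableAt)
    (fun y => (hd y).deriv) x a
  simp only [sub_self, mul_zero, neg_zero, Real.exp_zero, mul_one] at hc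
  rw [← hc, mul_assoc, ← Real.exp_add, neg_add_cancel, Real.exp_zero, mul_one]

/-- If the characteristic roots `r, s` of a linear second order equation are real, a solution
vanishing at `a` with positive slope there becomes monotone after multiplication
by `exp (-s * x)`. -/
theorem monotone_mul_exp_of_hasDerivAt {f f' : ℝ → ℝ} {r s a : ℝ}
    (hf : ∀ x, HasDerivAt f (f' x) x)
    (hf' : ∀ x, HasDerivAt f' ((r + s) * f' x - r * s * f x) x)
    (ha : f a = 0) (ha' : 0 < f' a) :
    Monotone fun x => f x * Real.exp (-(s * x)) := by
  have hh : ∀ x, HasDerivAt (fun x => f' x - s * f x) (r * (f' x - s * f x)) x := by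
    intro x
    refine HasDerivAt.congr_deriv ((hf' x).sub ((hf x).const_mul s)) ?_
    ring
  have hpos : ∀ x, 0 < f' x - s * f x := by
    intro x
    have h := eq_mul_exp_of_hasDerivAt hh a x
    simp only [ha, mul_zero, sub_zero] at h
    rw [h]
    positivity
  have hd : ∀ x, HasDerivAt (fun x => f x * Real.exp (-(s * x)))
      ((f' x - s * f x) * Real.exp (-(s * x))) x := by
    intro x
    have he : HasDerivAt (fun y : ℝ => -(s * y)) (-(s * 1)) x :=
      ((hasDerivAt_id x).const_mul s).neg
    refine HasDerivAt.congr_deriv ((hf x).mul he.exp) ?_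
    ring
  refine monotone_of_deriv_nonneg (fun x => (hd x).differentiableAt) fun x => ?_
  rw [(hd x).deriv]
  exact (mul_pos (hpos x) (Real.exp_pos _)).le

/-- A solution of `-ε f'' - b f' + c f = 0` with `f a = 0` and `f' a > 0` is nonnegative to the
right of `a` and nonpositive to its left. -/
theorem sign_of_ode {ε b c a : ℝ} (hε : 0 < ε) (hc : 0 < c) {f f' : ℝ → ℝ}
    (hf : ∀ x, HasDerivAt f (f' x) x)
    (hf' : ∀ x, HasDerivAt f' ((c * f x - b * f' x) / ε) x)
    (ha : f a = 0) (ha' : 0 < f' a) :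
    (∀ x, a ≤ x → 0 ≤ f x) ∧ ∀ x, x ≤ a → f x ≤ 0 := by
  obtain ⟨r, s, hadd, hmul⟩ : ∃ r s : ℝ, r + s = -b / ε ∧ r * s = -c / ε := by
    have hD : 0 ≤ b ^ 2 + 4 * ε * c := by positivity
    refine ⟨(-b + √(b ^ 2 + 4 * ε * c)) / (2 * ε), (-b - √(b ^ 2 + 4 * ε * c)) / (2 * ε), ?_, ?_⟩
    · field_simp
      ring
    · have hsq := Real.sq_sqrt hD
      field_simp
      linear_combination -hsq
  have hm := monotone_mul_exp_of_hasDerivAt (r := r) (s := s) hf (fun x => by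
    refine HasDerivAt.congr_deriv (hf' x) ?_
    rw [hadd, hmul]
    ring) ha ha'
  constructor
  · intro x hx
    have h := hm hx
    simp only [ha, zero_mul] at h
    exact nonneg_of_mul_nonneg_left h (Real.exp_pos _)
  · intro x hx
    have h := hm hx
    simp only [ha, zero_mul] at h
    exact nonpos_of_mul_nonpos_left h (Real.exp_pos _)

/-- If `v` solves `-ε v'' - b v' + c v = 0` and `w' = -(b / ε) w`, then `v' / (c w)` is a primitive
of `v / (ε w)`. -/
theorem integral_div_of_ode {ε b c : ℝ} (hε : 0 < ε) (hc : 0 < c) {v v' w : ℝ → ℝ}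
    (hv : ∀ x, HasDerivAt v (v' x) x)
    (hv' : ∀ x, HasDerivAt v' ((c * v x - b * v' x) / ε) x)
    (hw : ∀ x, HasDerivAt w (-(b / ε) * w x) x) (hw0 : ∀ x, w x ≠ 0) (p q : ℝ) :
    IntervalIntegrable (fun t => v t / (ε * w t)) MeasureTheory.volume p q ∧
      ∫ t in p..q, v t / (ε * w t) = v' q / (c * w q) - v' p / (c * w p) := by
  have hvc : Continuous v := continuous_iff_continuousAt.2 fun x => (hv x).continuousAt
  have hwc : Continuous w := continuous_iff_continuousAt.2 fun x => (hw x).continuousAt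
  have hcont : Continuous fun t => v t / (ε * w t) :=
    hvc.div (continuous_const.mul hwc) fun x => mul_ne_zero hε.ne' (hw0 x)
  refine ⟨hcont.intervalIntegrable p q, ?_⟩
  refine intervalIntegral.integral_eq_sub_of_hasDerivAt (f := fun t => v' t / (c * w t))
    (fun t _ => ?_) (hcont.intervalIntegrable p q)
  have h0 := hw0 t
  refine HasDerivAt.congr_deriv ((hv' t).div ((hw t).const_mul c) (mul_ne_zero hc.ne' h0)) ?_
  field_simp
  ring

/-- Uniform `L¹` bound for the Green's function: there exist `C > 0` and `ε₀ > 0`,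
depending only on `b` and `c`, such that `∫₀¹ |G(x,t)| dt ≤ C` for every `ε ∈ (0, ε₀]`
and every `x ∈ [0,1]`. -/
theorem green_function_L1_bound (b c : ℝ) (hb : 0 < b) (hc : 0 < c) :
    ∃ C > (0:ℝ), ∃ ε₀ > (0:ℝ), ∀ ε ∈ Set.Ioc (0:ℝ) ε₀,
      ∀ v₁ v₂ w : ℝ → ℝ, ∀ G : ℝ → ℝ → ℝ,
        ContDiff ℝ 2 v₁ → ContDiff ℝ 2 v₂ →
        (∀ x, -ε * deriv (deriv v₁) x - b * deriv v₁ x + c * v₁ x = 0) →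
        v₁ 0 = 0 → deriv v₁ 0 = 1 →
        (∀ x, -ε * deriv (deriv v₂) x - b * deriv v₂ x + c * v₂ x = 0) →
        v₂ 1 = 0 → deriv v₂ 1 = 1 →
        (w = fun x => v₁ x * deriv v₂ x - deriv v₁ x * v₂ x) →
        (∀ x ∈ Icc (0:ℝ) 1, w x ≠ 0) →
        (G = fun x t =>
          if x ≤ t then -(v₁ x * v₂ t) / (ε * w t) else -(v₁ t * v₂ x) / (ε * w t)) →
        ∀ x ∈ Icc (0:ℝ) 1, (∫ t in (0:ℝ)..1, |G x t|) ≤ C := by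
  refine ⟨1 / c, by positivity, 1, one_pos, ?_⟩
  rintro ε ⟨hε, -⟩ v₁ v₂ w G hv₁ hv₂ ode₁ hv₁0 hv₁0' ode₂ hv₂1 hv₂1' hw hw0 hG x ⟨hx0, hx1⟩
  have hder : ∀ v : ℝ → ℝ, ContDiff ℝ 2 v →
      (∀ x, -ε * deriv (deriv v) x - b * deriv v x + c * v x = 0) →
      (∀ x, HasDerivAt v (deriv v x) x) ∧
      ∀ x, HasDerivAt (deriv v) ((c * v x - b * deriv v x) / ε) x := by
    intro v hv ode
    refine ⟨fun y => (hv.differentiable (by norm_num) y).hasDerivAt, fun y => ?_⟩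
    have h2 : ContDiff ℝ 1 (deriv v) := ContDiff.deriv' hv
    refine HasDerivAt.congr_deriv ((h2.differentiable (by norm_num) y).hasDerivAt) ?_
    rw [eq_div_iff hε.ne']
    linear_combination -ode y
  obtain ⟨d₁, d₁'⟩ := hder v₁ hv₁ ode₁
  obtain ⟨d₂, d₂'⟩ := hder v₂ hv₂ ode₂
  have sv₁ := (sign_of_ode hε hc d₁ d₁' hv₁0 (by rw [hv₁0']; exact one_pos)).1
  have sv₂ := (sign_of_ode hε hc d₂ d₂' hv₂1 (by rw [hv₂1']; exact one_pos)).2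
  have dw : ∀ y, HasDerivAt w (-(b / ε) * w y) y := by
    intro y
    rw [hw]
    refine HasDerivAt.congr_deriv (((d₁ y).mul (d₂' y)).sub ((d₁' y).mul (d₂ y))) ?_
    field_simp
    ring
  have hw_zero : w 0 = -v₂ 0 := by simp [hw, hv₁0, hv₁0']
  have hw_one : w 1 = v₁ 1 := by simp [hw, hv₂1, hv₂1']
  have hw0pos : 0 < w 0 := lt_of_le_of_ne
    (by rw [hw_zero]; linarith [sv₂ 0 zero_le_one]) (hw0 0 (by simp)).symm
  have hwpos : ∀ y, 0 < w y := by
    intro y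
    rw [eq_mul_exp_of_hasDerivAt dw 0 y]
    positivity
  obtain ⟨i₁, e₁⟩ := integral_div_of_ode hε hc d₁ d₁' dw (fun y => (hwpos y).ne') 0 x
  obtain ⟨i₂, e₂⟩ := integral_div_of_ode hε hc d₂ d₂' dw (fun y => (hwpos y).ne') x 1
  have g₁ : EqOn (fun t => -v₂ x * (v₁ t / (ε * w t))) (fun t => |G x t|) (uIcc 0 x) := by
    intro t ht
    rw [uIcc_of_le hx0] at ht
    have hGt : G x t = -v₂ x * (v₁ t / (ε * w t)) := by
      rw [hG]
      dsimp only
      split_ifs with h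
      · rw [le_antisymm h ht.2]
        ring
      · ring
    have hnn : 0 ≤ -v₂ x * (v₁ t / (ε * w t)) := mul_nonneg (by linarith [sv₂ x hx1])
      (div_nonneg (sv₁ t ht.1) (mul_pos hε (hwpos t)).le)
    simp only [hGt, abs_of_nonneg hnn]
  have g₂ : EqOn (fun t => -v₁ x * (v₂ t / (ε * w t))) (fun t => |G x t|) (uIcc x 1) := by
    intro t ht
    rw [uIcc_of_le hx1] at ht
    have hGt : G x t = -v₁ x * (v₂ t / (ε * w t)) := by
      rw [hG]
      dsimp only
      rw [if_pos ht.1]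
      ring
    have hnn : 0 ≤ -v₁ x * (v₂ t / (ε * w t)) := mul_nonneg_of_nonpos_of_nonpos
      (by linarith [sv₁ x hx0])
      (div_nonpos_of_nonpos_of_nonneg (sv₂ t ht.2) (mul_pos hε (hwpos t)).le)
    simp only [hGt, abs_of_nonneg hnn]
  have j₁ := (i₁.const_mul (-v₂ x)).congr (g₁.mono uIoc_subset_uIcc)
  have j₂ := (i₂.const_mul (-v₁ x)).congr (g₂.mono uIoc_subset_uIcc)
  rw [← intervalIntegral.integral_add_adjacent_intervals j₁ j₂,
    ← intervalIntegral.integral_congr g₁, ← intervalIntegral.integral_congr g₂,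
    intervalIntegral.integral_const_mul, intervalIntegral.integral_const_mul, e₁, e₂,
    hv₁0', hv₂1']
  have hwx : w x = v₁ x * deriv v₂ x - deriv v₁ x * v₂ x := by rw [hw]
  have hx : (v₁ x * deriv v₂ x - deriv v₁ x * v₂ x) / (c * w x) = 1 / c := by
    rw [← hwx]
    have := hwpos x
    field_simp
  have k₁ : v₂ x / (c * w 0) ≤ 0 :=
    div_nonpos_of_nonpos_of_nonneg (sv₂ x hx1) (mul_pos hc hw0pos).le
  have k₂ : 0 ≤ v₁ x / (c * w 1) := div_nonneg (sv₁ x hx0) (mul_pos hc (hwpos 1)).le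
  rw [← hx]
  calc _ = (v₁ x * deriv v₂ x - deriv v₁ x * v₂ x) / (c * w x)
        + v₂ x / (c * w 0) - v₁ x / (c * w 1) := by ring
    _ ≤ _ := by linarith
end

section
/- There exist constants C > 0 and ε₀ > 0, depending only on b and c, such that for every ε ∈ (0, ε₀] it holds ∫₀¹ |G_x(1,t)| dt ≤ C, where G_x(1,t) denotes the partial derivative of G with respect to its first argument evaluated at x = 1. -/
open Set

/-- The logarithmic weight `exp (k x)` for which `(exp (k x) v')' = exp (k x) (v'' + k v')`. -/
lemma hasDerivAt_exp_mul (k x : ℝ) :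
    HasDerivAt (fun x => Real.exp (k * x)) (Real.exp (k * x) * k) x := by
  simpa using ((hasDerivAt_id x).const_mul k).exp

/-- If `v'' = m v - k v'` with `m ≥ 0` and `v 0 = 0`, then `|v|` is nondecreasing on `[0, ∞)`. -/
lemma abs_le_abs_of_deriv_deriv_eq {v : ℝ → ℝ} {k m : ℝ} (hv : Differentiable ℝ v)
    (hv' : Differentiable ℝ (deriv v)) (hm : 0 ≤ m)
    (hode : ∀ x, deriv (deriv v) x = m * v x - k * deriv v x) (h0 : v 0 = 0)
    {s t : ℝ} (hs : 0 ≤ s) (hst : s ≤ t) : |v s| ≤ |v t| := by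
  have hp : ∀ x, HasDerivAt (fun x => Real.exp (k * x) * (v x * deriv v x))
      (Real.exp (k * x) * (deriv v x ^ 2 + m * v x ^ 2)) x := by
    intro x
    refine ((hasDerivAt_exp_mul k x).mul
      ((hv x).hasDerivAt.mul (hv' x).hasDerivAt)).congr_deriv ?_
    rw [hode x, Pi.mul_apply]
    ring
  have hmono : Monotone (fun x => Real.exp (k * x) * (v x * deriv v x)) :=
    monotone_of_hasDerivAt_nonneg hp fun x => by
      simp only [Pi.zero_apply]
      positivity
  have hnn : ∀ x, 0 ≤ x → 0 ≤ v x * deriv v x := by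
    intro x hx
    have h := hmono hx
    simp only [h0, zero_mul, mul_zero] at h
    exact nonneg_of_mul_nonneg_right h (Real.exp_pos _)
  have hsq : ∀ x, HasDerivAt (fun x => v x ^ 2) (2 * (v x * deriv v x)) x := by
    intro x
    refine ((hv x).hasDerivAt.pow 2).congr_deriv ?_
    push_cast
    ring
  have hsqmono : MonotoneOn (fun x => v x ^ 2) (Ici 0) := by
    refine monotoneOn_of_deriv_nonneg (convex_Ici 0)
      (fun x _ => (hsq x).continuousAt.continuousWithinAt)
      (fun x _ => (hsq x).differentiableAt.differentiableWithinAt) fun x hx => ?_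
    rw [interior_Ici] at hx
    rw [(hsq x).deriv]
    exact mul_nonneg zero_le_two (hnn x (le_of_lt hx))
  exact sq_le_sq.mp (hsqmono hs (hs.trans hst) hst)

/-- Abel's identity for `v'' = m v - k v'`. -/
lemma exp_mul_wronskian_eq {u v : ℝ → ℝ} {k m : ℝ} (hu : Differentiable ℝ u)
    (hu' : Differentiable ℝ (deriv u)) (hv : Differentiable ℝ v)
    (hv' : Differentiable ℝ (deriv v))
    (hodeu : ∀ x, deriv (deriv u) x = m * u x - k * deriv u x)
    (hodev : ∀ x, deriv (deriv v) x = m * v x - k * deriv v x) (s t : ℝ) :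
    Real.exp (k * s) * (u s * deriv v s - deriv u s * v s) =
      Real.exp (k * t) * (u t * deriv v t - deriv u t * v t) := by
  have hp : ∀ x, HasDerivAt
      (fun x => Real.exp (k * x) * (u x * deriv v x - deriv u x * v x)) 0 x := by
    intro x
    refine ((hasDerivAt_exp_mul k x).mul
      (((hu x).hasDerivAt.mul (hv' x).hasDerivAt).sub
        ((hu' x).hasDerivAt.mul (hv x).hasDerivAt))).congr_deriv ?_
    simp only [Pi.sub_apply, Pi.mul_apply, hodeu x, hodev x]
    ring
  exact is_const_of_deriv_eq_zero (fun x => (hp x).differentiableAt) (fun x => (hp x).deriv) s t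

/-- The total mass of the boundary layer function `exp (-b (1 - t) / ε) / ε` is at most `1 / b`. -/
lemma integral_exp_div_le {b ε : ℝ} (hb : 0 < b) (hε : 0 < ε) :
    ∫ t in (0:ℝ)..1, Real.exp (b / ε * t - b / ε) / ε ≤ 1 / b := by
  have hd : ∀ t ∈ uIcc (0:ℝ) 1, HasDerivAt (fun t => Real.exp (b / ε * t - b / ε) / b)
      (Real.exp (b / ε * t - b / ε) / ε) t := by
    intro t _
    have h : HasDerivAt (fun t => b / ε * t - b / ε) (b / ε) t := by
      simpa using ((hasDerivAt_id t).const_mul (b / ε)).sub_const (b / ε)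
    refine (h.exp.div_const b).congr_deriv ?_
    field_simp
  rw [intervalIntegral.integral_eq_sub_of_hasDerivAt hd
    ((by fun_prop : Continuous fun t => Real.exp (b / ε * t - b / ε) / ε).intervalIntegrable _ _)]
  have : 0 ≤ Real.exp (b / ε * 0 - b / ε) / b := by positivity
  simp only [mul_one, sub_self, Real.exp_zero]
  linarith

/-- There exist `C > 0` and `ε₀ > 0`, depending only on `b` and `c`, such that
`∫₀¹ |G_x(1,t)| dt ≤ C` for every `ε ∈ (0, ε₀]`, where `G_x` is the partial derivative of
`G` with respect to its first argument. -/
theorem green_function_Gx_one_bound (b c : ℝ) (hb : 0 < b) (hc : 0 < c) :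
    ∃ C > (0:ℝ), ∃ ε₀ > (0:ℝ), ∀ ε ∈ Set.Ioc (0:ℝ) ε₀,
      ∀ v₁ v₂ w : ℝ → ℝ, ∀ G : ℝ → ℝ → ℝ,
        ContDiff ℝ 2 v₁ → ContDiff ℝ 2 v₂ →
        (∀ x, -ε * deriv (deriv v₁) x - b * deriv v₁ x + c * v₁ x = 0) →
        v₁ 0 = 0 → deriv v₁ 0 = 1 →
        (∀ x, -ε * deriv (deriv v₂) x - b * deriv v₂ x + c * v₂ x = 0) →
        v₂ 1 = 0 → deriv v₂ 1 = 1 →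
        (w = fun x => v₁ x * deriv v₂ x - deriv v₁ x * v₂ x) →
        (∀ x ∈ Icc (0:ℝ) 1, w x ≠ 0) →
        (G = fun x t =>
          if x ≤ t then -(v₁ x * v₂ t) / (ε * w t) else -(v₁ t * v₂ x) / (ε * w t)) →
        (∫ t in (0:ℝ)..1, |deriv (fun y => G y t) 1|) ≤ C := by
  refine ⟨1 / b, by positivity, 1, one_pos, ?_⟩
  rintro ε ⟨hε, -⟩ v₁ v₂ w G hv₁ hv₂ hode₁ h₁0 - hode₂ h₂1 h₂1' rfl hw rfl
  have hode : ∀ v : ℝ → ℝ, (∀ x, -ε * deriv (deriv v) x - b * deriv v x + c * v x = 0) →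
      ∀ x, deriv (deriv v) x = c / ε * v x - b / ε * deriv v x := by
    intro v h x
    field_simp
    linarith [h x]
  have hdiff : ∀ v : ℝ → ℝ, ContDiff ℝ 2 v → Differentiable ℝ v ∧ Differentiable ℝ (deriv v) :=
    fun v h => ⟨h.differentiable (by norm_num),
      (ContDiff.deriv' (n := 1) (by simpa [one_add_one_eq_two] using h)).differentiable
        (by norm_num)⟩
  obtain ⟨hd₁, hd₁'⟩ := hdiff v₁ hv₁
  obtain ⟨hd₂, hd₂'⟩ := hdiff v₂ hv₂
  have hv₁1 : 0 < |v₁ 1| := by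
    have h := hw 1 (by simp)
    simp only [h₂1, h₂1', mul_one, mul_zero, sub_zero] at h
    exact abs_pos.mpr h
  have hbound : ∀ t ∈ Ioo (0:ℝ) 1,
      ‖|deriv (fun y => if y ≤ t
        then -(v₁ y * v₂ t) / (ε * (v₁ t * deriv v₂ t - deriv v₁ t * v₂ t))
        else -(v₁ t * v₂ y) / (ε * (v₁ t * deriv v₂ t - deriv v₁ t * v₂ t))) 1|‖
        ≤ Real.exp (b / ε * t - b / ε) / ε := by
    intro t ht
    have hwt := hw t ⟨ht.1.le, ht.2.le⟩
    have habel := exp_mul_wronskian_eq hd₁ hd₁' hd₂ hd₂' (hode v₁ hode₁) (hode v₂ hode₂) t 1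
    have hle : |v₁ t| ≤ |v₁ 1| := abs_le_abs_of_deriv_deriv_eq hd₁ hd₁' (by positivity)
      (hode v₁ hode₁) h₁0 ht.1.le ht.2.le
    simp only [h₂1, h₂1', mul_one, mul_zero, sub_zero] at habel
    beta_reduce at hwt
    generalize v₁ t * deriv v₂ t - deriv v₁ t * v₂ t = W at *
    have hder : deriv (fun y => if y ≤ t then -(v₁ y * v₂ t) / (ε * W)
        else -(v₁ t * v₂ y) / (ε * W)) 1 = -(v₁ t) / (ε * W) := by
      have h : HasDerivAt (fun y => -(v₁ t * v₂ y) / (ε * W)) (-(v₁ t) / (ε * W)) 1 := by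
        refine (((hd₂ 1).hasDerivAt.const_mul (v₁ t)).neg.div_const (ε * W)).congr_deriv ?_
        rw [h₂1', mul_one]
      refine (h.congr_of_eventuallyEq ?_).deriv
      filter_upwards [lt_mem_nhds ht.2] with y hy
      rw [if_neg (not_le.mpr hy)]
    have hW : |v₁ 1| = Real.exp (b / ε * t - b / ε) * |W| := by
      have h := congrArg abs habel
      rw [abs_mul, abs_mul, Real.abs_exp, Real.abs_exp] at h
      rw [Real.exp_sub, div_mul_eq_mul_div, h, mul_div_cancel_left₀ _ (Real.exp_ne_zero _)]
    have hWpos : 0 < |W| := abs_pos.mpr hwt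
    rw [hder, Real.norm_eq_abs, abs_abs, abs_div, abs_neg, abs_mul, abs_of_pos hε,
      div_le_div_iff₀ (by positivity) hε]
    calc |v₁ t| * ε ≤ (Real.exp (b / ε * t - b / ε) * |W|) * ε := by
          rw [← hW]
          gcongr
      _ = Real.exp (b / ε * t - b / ε) * (ε * |W|) := by ring
  have hint : IntervalIntegrable (fun t => Real.exp (b / ε * t - b / ε) / ε)
      MeasureTheory.volume 0 1 :=
    (by fun_prop : Continuous fun t => Real.exp (b / ε * t - b / ε) / ε).intervalIntegrable _ _
  refine (Real.le_norm_self _).trans (le_trans ?_ (integral_exp_div_le hb hε))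
  refine intervalIntegral.norm_integral_le_of_norm_le zero_le_one ?_ hint
  have hne : ∀ᵐ t : ℝ, t ≠ 1 := MeasureTheory.Measure.ae_ne _ 1
  filter_upwards [hne] with t ht1 ht
  exact hbound t ⟨ht.1, lt_of_le_of_ne ht.2 ht1⟩
end

section
/- There exist constants C > 0 and ε₀ > 0, depending only on b and c, such that for every ε ∈ (0, ε₀] it holds ∫₀¹ |G_x(0,t)| dt ≤ C/ε and ∫₀¹ |G_x(0,t)| t dt ≤ C/ε, where G_x(0,t) denotes the partial derivative of G with respect to its first argument evaluated at x = 0. -/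
open Set

/-- Solutions of `-ε v'' - b v' + c v = 0` with `v 1 = 0` satisfy
`e^{b t / ε} |v t| ≤ |v 0|` on `[0, 1]`: the square of the left-hand side is antitone. -/
lemma exp_mul_abs_le_of_ode {b c ε : ℝ} (hc : 0 < c) (hε : 0 < ε) {v v' v'' : ℝ → ℝ}
    (hv : ∀ x, HasDerivAt v (v' x) x) (hv' : ∀ x, HasDerivAt v' (v'' x) x)
    (hode : ∀ x, -ε * v'' x - b * v' x + c * v x = 0) (h1 : v 1 = 0)
    {t : ℝ} (ht : t ∈ Icc (0 : ℝ) 1) :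
    Real.exp (b / ε * t) * |v t| ≤ |v 0| := by
  have hexp : ∀ x, HasDerivAt (fun x => Real.exp (b / ε * x))
      (Real.exp (b / ε * x) * (b / ε)) x := fun x => by
    simpa using ((hasDerivAt_id x).const_mul (b / ε)).exp
  set q : ℝ → ℝ := fun x => Real.exp (b / ε * x) * (v x * (v' x + b / ε * v x)) with hq
  have hq' : ∀ x, HasDerivAt q
      (Real.exp (b / ε * x) * ((v' x + b / ε * v x) ^ 2 + c / ε * v x ^ 2)) x := fun x => by
    have hv2 : v'' x = -(b / ε) * v' x + c / ε * v x := by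
      field_simp
      linarith [hode x]
    refine ((hexp x).mul ((hv x).mul ((hv' x).add ((hv x).const_mul (b / ε))))).congr_deriv ?_
    simp only [Pi.add_apply, Pi.mul_apply]
    rw [hv2]
    ring
  have hmono : Monotone q := monotone_of_hasDerivAt_nonneg hq' fun x => by
    simp only [Pi.zero_apply]
    positivity
  have hq_nonpos : ∀ x ≤ 1, q x ≤ 0 := fun x hx => by
    simpa [hq, h1] using hmono hx
  have hS : ∀ x, HasDerivAt (fun x => (Real.exp (b / ε * x) * v x) ^ 2)
      (2 * Real.exp (b / ε * x) * q x) x := fun x => by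
    refine (((hexp x).mul (hv x)).pow 2).congr_deriv ?_
    simp only [hq, Pi.mul_apply]
    ring
  have hanti : AntitoneOn (fun x => (Real.exp (b / ε * x) * v x) ^ 2) (Icc 0 1) := by
    refine antitoneOn_of_hasDerivWithinAt_nonpos (convex_Icc 0 1)
      (fun x _ => (hS x).continuousAt.continuousWithinAt)
      (fun x _ => (hS x).hasDerivWithinAt) fun x hx => ?_
    exact mul_nonpos_of_nonneg_of_nonpos (by positivity)
      (hq_nonpos x (interior_subset hx).2)
  have := sq_le_sq.mp (hanti (left_mem_Icc.mpr zero_le_one) ht ht.1)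
  simpa [abs_mul] using this

/-- Abel's identity for two solutions of `-ε v'' - b v' + c v = 0`. -/
lemma exp_mul_wronskian_eq_s10 {b c ε : ℝ} (hε : 0 < ε) {v v' v'' u u' u'' : ℝ → ℝ}
    (hv : ∀ x, HasDerivAt v (v' x) x) (hv' : ∀ x, HasDerivAt v' (v'' x) x)
    (hu : ∀ x, HasDerivAt u (u' x) x) (hu' : ∀ x, HasDerivAt u' (u'' x) x)
    (hodev : ∀ x, -ε * v'' x - b * v' x + c * v x = 0)
    (hodeu : ∀ x, -ε * u'' x - b * u' x + c * u x = 0) (t : ℝ) :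
    Real.exp (b / ε * t) * (v t * u' t - v' t * u t) = v 0 * u' 0 - v' 0 * u 0 := by
  have hd : ∀ x, HasDerivAt (fun x => Real.exp (b / ε * x) * (v x * u' x - v' x * u x)) 0 x :=
    fun x => by
    have hv2 : v'' x = -(b / ε) * v' x + c / ε * v x := by
      field_simp
      linarith [hodev x]
    have hu2 : u'' x = -(b / ε) * u' x + c / ε * u x := by
      field_simp
      linarith [hodeu x]
    have hexp : HasDerivAt (fun x => Real.exp (b / ε * x))
        (Real.exp (b / ε * x) * (b / ε)) x := by
      simpa using ((hasDerivAt_id x).const_mul (b / ε)).exp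
    refine (hexp.mul (((hv x).mul (hu' x)).sub ((hv' x).mul (hu x)))).congr_deriv ?_
    simp only [Pi.sub_apply, Pi.mul_apply]
    rw [hv2, hu2]
    ring
  simpa using is_const_of_deriv_eq_zero (fun x => (hd x).differentiableAt)
    (fun x => (hd x).deriv) t 0

/-- The first and second derivatives of a `C²` function are genuine derivatives. -/
lemma ContDiff.hasDerivAt_deriv_deriv {v : ℝ → ℝ} (h : ContDiff ℝ 2 v) (x : ℝ) :
    HasDerivAt v (deriv v x) x ∧ HasDerivAt (deriv v) (deriv (deriv v) x) x := by
  refine ⟨(h.differentiable (by norm_num) x).hasDerivAt, ?_⟩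
  have h' : ContDiff ℝ (1 + 1) v := by simpa [one_add_one_eq_two] using h
  exact ((contDiff_succ_iff_deriv.mp h').2.2.differentiable (by norm_num) x).hasDerivAt

/-- There exist `C > 0` and `ε₀ > 0`, depending only on `b` and `c`, such that
`∫₀¹ |G_x(0,t)| dt ≤ C/ε` and `∫₀¹ |G_x(0,t)| t dt ≤ C/ε` for every `ε ∈ (0, ε₀]`, where
`G_x` is the partial derivative of `G` with respect to its first argument. -/
theorem green_function_Gx_zero_bound (b c : ℝ) (hb : 0 < b) (hc : 0 < c) :
    ∃ C > (0:ℝ), ∃ ε₀ > (0:ℝ), ∀ ε ∈ Set.Ioc (0:ℝ) ε₀,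
      ∀ v₁ v₂ w : ℝ → ℝ, ∀ G : ℝ → ℝ → ℝ,
        ContDiff ℝ 2 v₁ → ContDiff ℝ 2 v₂ →
        (∀ x, -ε * deriv (deriv v₁) x - b * deriv v₁ x + c * v₁ x = 0) →
        v₁ 0 = 0 → deriv v₁ 0 = 1 →
        (∀ x, -ε * deriv (deriv v₂) x - b * deriv v₂ x + c * v₂ x = 0) →
        v₂ 1 = 0 → deriv v₂ 1 = 1 →
        (w = fun x => v₁ x * deriv v₂ x - deriv v₁ x * v₂ x) →
        (∀ x ∈ Icc (0:ℝ) 1, w x ≠ 0) →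
        (G = fun x t =>
          if x ≤ t then -(v₁ x * v₂ t) / (ε * w t) else -(v₁ t * v₂ x) / (ε * w t)) →
        (∫ t in (0:ℝ)..1, |deriv (fun y => G y t) 0|) ≤ C / ε ∧
        (∫ t in (0:ℝ)..1, |deriv (fun y => G y t) 0| * t) ≤ C / ε := by
  refine ⟨1, one_pos, 1, one_pos, ?_⟩
  intro ε hε v₁ v₂ w G h₁ h₂ hode₁ h₁0 h₁0' hode₂ h₂1 _ hw hw0 hG
  have hε0 : 0 < ε := hε.1
  have key : ∀ t ∈ Ioc (0 : ℝ) 1, |deriv (fun y => G y t) 0| ≤ 1 / ε := fun t ht => by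
    have htI : t ∈ Icc (0 : ℝ) 1 := Ioc_subset_Icc_self ht
    have hle := exp_mul_abs_le_of_ode hc hε0 (fun x => (h₂.hasDerivAt_deriv_deriv x).1)
      (fun x => (h₂.hasDerivAt_deriv_deriv x).2) hode₂ h₂1 htI
    have hwr := exp_mul_wronskian_eq_s10 hε0 (fun x => (h₁.hasDerivAt_deriv_deriv x).1)
      (fun x => (h₁.hasDerivAt_deriv_deriv x).2) (fun x => (h₂.hasDerivAt_deriv_deriv x).1)
      (fun x => (h₂.hasDerivAt_deriv_deriv x).2) hode₁ hode₂ t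
    have hwt : w t = v₁ t * deriv v₂ t - deriv v₁ t * v₂ t := by rw [hw]
    rw [← hwt, h₁0, h₁0', zero_mul, one_mul, zero_sub] at hwr
    have hvw : |v₂ t| ≤ |w t| := by
      rw [← abs_neg (v₂ 0), ← hwr, abs_mul, abs_of_pos (Real.exp_pos _)] at hle
      exact le_of_mul_le_mul_left hle (Real.exp_pos _)
    have hloc : (fun y => G y t) =ᶠ[nhds 0] fun y => -(v₁ y * v₂ t) / (ε * w t) := by
      filter_upwards [Iic_mem_nhds ht.1] with y hy
      rw [hG]
      exact if_pos hy
    have hd : HasDerivAt (fun y => -(v₁ y * v₂ t) / (ε * w t))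
        (-(1 * v₂ t) / (ε * w t)) 0 := by
      rw [← h₁0']
      exact (((h₁.hasDerivAt_deriv_deriv 0).1.mul_const (v₂ t)).neg).div_const _
    have hwpos : 0 < |w t| := abs_pos.mpr (hw0 t htI)
    rw [hloc.deriv_eq, hd.deriv, one_mul, abs_div, abs_neg, abs_mul, abs_of_pos hε0,
      div_le_div_iff₀ (by positivity) hε0]
    nlinarith
  have hbound : ∀ f : ℝ → ℝ, (∀ t ∈ Ioc (0 : ℝ) 1, |f t| ≤ 1 / ε) →
      (∫ t in (0 : ℝ)..1, f t) ≤ 1 / ε := fun f hf => by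
    have h := intervalIntegral.norm_integral_le_of_norm_le_const (a := 0) (b := 1) (f := f)
      (C := 1 / ε) fun t ht => hf t (by rwa [uIoc_of_le zero_le_one] at ht)
    simpa using (le_abs_self _).trans h
  refine ⟨hbound _ fun t ht => by simpa using key t ht, hbound _ fun t ht => ?_⟩
  rw [abs_mul, abs_abs, abs_of_pos ht.1]
  exact (mul_le_of_le_one_right (abs_nonneg _) ht.2).trans (key t ht)
end

section
/- Let b > 0, let P be a real polynomial of degree at most m, and let A ∈ ℝ. Then there exists exactly one bounded C² function E : [0,∞) → ℝ satisfying E''(ξ) + b E'(ξ) = P(ξ) e^{−bξ} for all ξ > 0, E(0) = A, and lim_{ξ→∞} E(ξ) = 0; moreover this solution has the form E(ξ) = Q(ξ) e^{−bξ} for some real polynomial Q of degree at most m + 1. -/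
open Set

lemma Polynomial.exists_derivative_eq {n : ℕ} (R : Polynomial ℝ) (hR : R.natDegree ≤ n) :
    ∃ Q : Polynomial ℝ, Q.natDegree ≤ n + 1 ∧ Q.derivative = R ∧ Q.eval 0 = 0 := by
  refine ⟨∑ i ∈ Finset.range (n + 1), C (R.coeff i / (i + 1)) * X ^ (i + 1), ?_, ?_, ?_⟩
  · refine natDegree_sum_le_of_forall_le _ _ fun i hi => ?_
    refine (natDegree_C_mul_X_pow_le _ _).trans ?_
    have := Finset.mem_range.mp hi
    omega
  · conv_rhs => rw [R.as_sum_range_C_mul_X_pow' (Nat.lt_succ_of_le hR)]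
    rw [derivative_sum]
    refine Finset.sum_congr rfl fun i _ => ?_
    have hi : (i : ℝ) + 1 ≠ 0 := by positivity
    rw [derivative_C_mul_X_pow]
    push_cast
    rw [div_mul_cancel₀ _ hi]
  · simp [eval_finsetSum]

lemma Polynomial.exists_derivative_sub_C_mul_eq {b : ℝ} (hb : b ≠ 0) (n : ℕ) (P : Polynomial ℝ)
    (hP : P.natDegree ≤ n) :
    ∃ R : Polynomial ℝ, R.natDegree ≤ n ∧ R.derivative - C b * R = P := by
  have hC : C b * C b⁻¹ = (1 : Polynomial ℝ) := by rw [← C_mul, mul_inv_cancel₀ hb, C_1]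
  induction n generalizing P with
  | zero =>
    refine ⟨C b⁻¹ * -P, ?_, ?_⟩
    · exact (natDegree_C_mul_le _ _).trans (by simpa using hP)
    · have hd : derivative P = 0 := derivative_of_natDegree_zero (Nat.le_zero.mp hP)
      rw [derivative_C_mul, derivative_neg, hd]
      linear_combination P * hC
  | succ n ih =>
    obtain ⟨S, hS, hSP⟩ := ih (derivative P) ((natDegree_derivative_le P).trans (by omega))
    refine ⟨C b⁻¹ * (S - P), ?_, ?_⟩
    · exact (natDegree_C_mul_le _ _).trans
        ((natDegree_sub_le _ _).trans (max_le (hS.trans n.le_succ) hP))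
    · rw [derivative_C_mul, derivative_sub]
      linear_combination C b⁻¹ * hSP + P * hC

lemma Polynomial.hasDerivAt_eval_mul_exp (b : ℝ) (Q : Polynomial ℝ) (x : ℝ) :
    HasDerivAt (fun ξ => Q.eval ξ * Real.exp (-b * ξ))
      ((derivative Q - C b * Q).eval x * Real.exp (-b * x)) x := by
  have h := (Q.hasDerivAt x).mul (((hasDerivAt_id x).const_mul (-b)).exp)
  refine h.congr_deriv ?_
  simp
  ring

lemma Polynomial.tendsto_eval_mul_exp_atTop {b : ℝ} (hb : 0 < b) (Q : Polynomial ℝ) :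
    Filter.Tendsto (fun ξ => Q.eval ξ * Real.exp (-b * ξ)) Filter.atTop (nhds 0) := by
  have hbx : Filter.Tendsto (fun ξ : ℝ => b * ξ) Filter.atTop Filter.atTop :=
    Filter.tendsto_id.const_mul_atTop hb
  have h := (Polynomial.tendsto_div_exp_atTop (Q.comp (C b⁻¹ * X))).comp hbx
  refine h.congr fun ξ => ?_
  simp [Real.exp_neg, div_eq_mul_inv, inv_mul_cancel_left₀ hb.ne']

lemma exists_abs_le_of_tendsto_atTop {E : ℝ → ℝ} (hE : Continuous E) {l : ℝ}
    (hl : Filter.Tendsto E Filter.atTop (nhds l)) :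
    ∃ M : ℝ, ∀ ξ ≥ (0 : ℝ), |E ξ| ≤ M := by
  obtain ⟨N, hN⟩ := Filter.eventually_atTop.mp
    (hl.abs.eventually (gt_mem_nhds (lt_add_one |l|)))
  obtain ⟨M, hM⟩ := (isCompact_Icc (a := (0 : ℝ)) (b := N)).exists_bound_of_continuousOn
    hE.continuousOn
  refine ⟨max M (|l| + 1), fun ξ hξ => ?_⟩
  rcases le_total ξ N with h | h
  · exact le_max_of_le_left (hM ξ ⟨hξ, h⟩)
  · exact le_max_of_le_right (hN ξ h).le

lemma exists_eq_const_of_hasDerivAt_zero_Ioi {f : ℝ → ℝ}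
    (hf : ∀ x > (0 : ℝ), HasDerivAt f 0 x) : ∃ c : ℝ, ∀ x > (0 : ℝ), f x = c :=
  isOpen_Ioi.exists_is_const_of_deriv_eq_zero isPreconnected_Ioi
    (fun x hx => (hf x hx).differentiableAt.differentiableWithinAt) fun x hx => (hf x hx).deriv

lemma eq_zero_of_homogeneous_layer_equation {b : ℝ} (hb : 0 < b) {D D' : ℝ → ℝ}
    (hD : ∀ x > (0 : ℝ), HasDerivAt D (D' x) x)
    (hD' : ∀ x > (0 : ℝ), HasDerivAt D' (-b * D' x) x)
    (hcont : ContinuousWithinAt D (Ioi 0) 0) (h0 : D 0 = 0)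
    (hlim : Filter.Tendsto D Filter.atTop (nhds 0)) :
    ∀ x > (0 : ℝ), D x = 0 := by
  obtain ⟨c, hc⟩ := exists_eq_const_of_hasDerivAt_zero_Ioi (f := fun x => D' x + b * D x)
    fun x hx => ((hD' x hx).add ((hD x hx).const_mul b)).congr_deriv (by ring)
  obtain ⟨k, hk⟩ := exists_eq_const_of_hasDerivAt_zero_Ioi
    (f := fun x => (D x - c / b) * Real.exp (b * x)) fun x hx => by
      refine (((hD x hx).sub_const (c / b)).mul
        (((hasDerivAt_id x).const_mul b).exp)).congr_deriv ?_
      have := hc x hx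
      simp only [id, mul_one]
      field_simp
      linear_combination Real.exp (b * x) * this
  have hform : ∀ x > (0 : ℝ), D x = c / b + k * Real.exp (-b * x) := fun x hx => by
    rw [← hk x hx, mul_assoc, ← Real.exp_add]
    simp
  have hexp : Filter.Tendsto (fun x => c / b + k * Real.exp (-b * x)) Filter.atTop
      (nhds (c / b)) := by
    simpa using (Polynomial.tendsto_eval_mul_exp_atTop hb (Polynomial.C k)).const_add (c / b)
  have hcb : c / b = 0 := tendsto_nhds_unique hexp
    (hlim.congr' ((Filter.eventually_gt_atTop 0).mono hform))
  have hk0 : k = 0 := by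
    have h1 : Filter.Tendsto D (nhdsWithin 0 (Ioi 0)) (nhds 0) := by
      simpa [ContinuousWithinAt, h0] using hcont
    have h2 : Filter.Tendsto (fun x => c / b + k * Real.exp (-b * x)) (nhdsWithin 0 (Ioi 0))
        (nhds (c / b + k * Real.exp (-b * 0))) :=
      (Continuous.tendsto (by fun_prop) 0).mono_left nhdsWithin_le_nhds
    have h3 := tendsto_nhds_unique h2
      (h1.congr' (eventually_mem_nhdsWithin.mono fun x hx => hform x hx))
    simpa [hcb] using h3
  intro x hx
  rw [hform x hx, hcb, hk0]
  simp

/-- Boundary-layer correction problem: for `b > 0`, a polynomial `P` of degree at most `m`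
and `A ∈ ℝ`, there is exactly one bounded `C²` function `E` on `[0,∞)` with
`E'' + b E' = P(ξ) e^{−bξ}` on `(0,∞)`, `E(0) = A` and `E(ξ) → 0` as `ξ → ∞`; moreover
`E(ξ) = Q(ξ) e^{−bξ}` for some polynomial `Q` of degree at most `m + 1`. -/
theorem boundary_layer_correction (b : ℝ) (hb : 0 < b) (m : ℕ)
    (P : Polynomial ℝ) (hP : P.degree ≤ m) (A : ℝ) :
    ∃ E : ℝ → ℝ,
      (ContDiffOn ℝ 2 E (Ici 0) ∧ (∃ M : ℝ, ∀ ξ ≥ (0:ℝ), |E ξ| ≤ M) ∧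
        (∀ ξ > (0:ℝ),
          deriv (deriv E) ξ + b * deriv E ξ = P.eval ξ * Real.exp (-b * ξ)) ∧
        E 0 = A ∧ Filter.Tendsto E Filter.atTop (nhds 0)) ∧
      (∃ Q : Polynomial ℝ, Q.degree ≤ (m + 1 : ℕ) ∧
        ∀ ξ ≥ (0:ℝ), E ξ = Q.eval ξ * Real.exp (-b * ξ)) ∧
      (∀ E' : ℝ → ℝ,
        (ContDiffOn ℝ 2 E' (Ici 0) ∧ (∃ M : ℝ, ∀ ξ ≥ (0:ℝ), |E' ξ| ≤ M) ∧
          (∀ ξ > (0:ℝ),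
            deriv (deriv E') ξ + b * deriv E' ξ = P.eval ξ * Real.exp (-b * ξ)) ∧
          E' 0 = A ∧ Filter.Tendsto E' Filter.atTop (nhds 0)) →
        ∀ ξ ≥ (0:ℝ), E' ξ = E ξ) := by
  obtain ⟨R, hRdeg, hR⟩ := Polynomial.exists_derivative_sub_C_mul_eq hb.ne' m P
    (Polynomial.natDegree_le_of_degree_le hP)
  obtain ⟨Q₀, hQ₀deg, hQ₀, hQ₀0⟩ := Polynomial.exists_derivative_eq R hRdeg
  set Q : Polynomial ℝ := Q₀ + Polynomial.C A with hQdef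
  have hQ : Polynomial.derivative Q = R := by simp [hQdef, hQ₀]
  have hE1 := Polynomial.hasDerivAt_eval_mul_exp b Q
  have hE2 := Polynomial.hasDerivAt_eval_mul_exp b (Polynomial.derivative Q - Polynomial.C b * Q)
  have hsmooth : ContDiff ℝ 2 (fun ξ => Q.eval ξ * Real.exp (-b * ξ)) := by
    have := Q.contDiff_aeval (𝕜 := ℝ) 2
    simp only [Polynomial.coe_aeval_eq_eval] at this
    fun_prop
  have hlim := Polynomial.tendsto_eval_mul_exp_atTop hb Q
  have hEeq : ∀ ξ : ℝ,
      (Polynomial.derivative (Polynomial.derivative Q - Polynomial.C b * Q) -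
        Polynomial.C b * (Polynomial.derivative Q - Polynomial.C b * Q)).eval ξ *
          Real.exp (-b * ξ) +
        b * ((Polynomial.derivative Q - Polynomial.C b * Q).eval ξ * Real.exp (-b * ξ)) =
      P.eval ξ * Real.exp (-b * ξ) := fun ξ => by
    rw [← hR, ← hQ]
    simp
    ring
  have hE0 : Q.eval 0 * Real.exp (-b * 0) = A := by simp [hQdef, hQ₀0]
  refine ⟨fun ξ => Q.eval ξ * Real.exp (-b * ξ), ⟨hsmooth.contDiffOn,
    exists_abs_le_of_tendsto_atTop hsmooth.continuous hlim, fun ξ _ => ?_, hE0, hlim⟩,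
    ⟨Q, ?_, fun ξ _ => rfl⟩, ?_⟩
  · rw [funext fun x => (hE1 x).deriv, (hE2 ξ).deriv]
    exact hEeq ξ
  · refine Polynomial.degree_le_of_natDegree_le ?_
    rwa [hQdef, Polynomial.natDegree_add_C]
  · rintro F ⟨hF, -, hFeq, hF0, hFlim⟩ ξ hξ
    have hFd : ∀ x > (0 : ℝ), HasDerivAt F (deriv F x) x := fun x hx =>
      ((hF.contDiffAt (Ici_mem_nhds hx)).differentiableAt (by norm_num)).hasDerivAt
    have hFdd : ∀ x > (0 : ℝ), HasDerivAt (deriv F) (deriv (deriv F) x) x := fun x hx =>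
      ((((hF.mono Ioi_subset_Ici_self).deriv_of_isOpen (m := 1) isOpen_Ioi
        (by norm_num)).contDiffAt (Ioi_mem_nhds hx)).differentiableAt (by norm_num)).hasDerivAt
    rcases hξ.eq_or_lt with rfl | hpos
    · exact hF0.trans hE0.symm
    · refine sub_eq_zero.mp (eq_zero_of_homogeneous_layer_equation hb
        (D := fun x => F x - Q.eval x * Real.exp (-b * x))
        (fun x hx => (hFd x hx).sub (hE1 x))
        (fun x hx => ((hFdd x hx).sub (hE2 x)).congr_deriv ?_) ?_ ?_ ?_ ξ hpos)
      · linear_combination hFeq x hx - hEeq x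
      · exact ((hF.continuousOn 0 self_mem_Ici).mono Ioi_subset_Ici_self).sub
          hsmooth.continuous.continuousWithinAt
      · simp only [hF0, hE0, sub_self]
      · simpa using hFlim.sub hlim
end
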